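/- arXiv:0910.4901 — 2 statements merged into one kernel-verified Lean document; each statement's English description precedes it below -/
import Mathlib

section
/- Let M_t, M_r be positive integers, M_* = min(M_t, M_r), and let d* : [0, ∞) → ℝ be the piecewise-linear function that interpolates the points (k, (M_t − k)(M_r − k)) for k = 0, 1, …, M_* and equals 0 for r ≥ M_*. Fix b ≥ 0 and an integer j with 0 ≤ j ≤ M_*. Then the line of slope −b through the corner point (j, d*(j)) lies on or below the DMT curve on [0, M_*], i.e., d*(j) + b(j − r) ≤ d*(r) for all r ∈ [0, M_*], if and only if both of the following hold: (j = 0 or b ≤ M_t + M_r − 2j + 1) and (j = M_* or b ≥ M_t + M_r − 2j − 1). -/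
open Finset

/-- Corner values of the DMT curve: `d*(k) = (Mt - k)(Mr - k)`. -/
noncomputable def cornerVal (Mt Mr k : ℕ) : ℝ := ((Mt : ℝ) - k) * ((Mr : ℝ) - k)

/-- The piecewise-linear DMT curve `d* : [0,∞) → ℝ` interpolating the points
`(k, (Mt-k)(Mr-k))` for `k = 0,…,min Mt Mr`, and equal to `0` for `r ≥ min Mt Mr`. -/
noncomputable def dstar (Mt Mr : ℕ) (r : ℝ) : ℝ :=
  if (min Mt Mr : ℝ) ≤ r then 0
  else (1 - (r - ⌊r⌋₊)) * cornerVal Mt Mr ⌊r⌋₊ + (r - ⌊r⌋₊) * cornerVal Mt Mr (⌊r⌋₊ + 1)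

/-- The optimal distortion exponent `Δ(b) = ∑_{i=1}^{M_*} min {b, 2i-1+M^*-M_*}`. -/
noncomputable def Delta (Mt Mr : ℕ) (b : ℝ) : ℝ :=
  ∑ i ∈ Finset.Icc 1 (min Mt Mr),
    min b (2 * (i : ℝ) - 1 + (max Mt Mr : ℝ) - (min Mt Mr : ℝ))

theorem cornerVal_min (Mt Mr : ℕ) : cornerVal Mt Mr (min Mt Mr) = 0 := by
  rcases min_choice Mt Mr with h | h <;> simp [cornerVal, h]

theorem dstar_natCast {Mt Mr k : ℕ} (hk : k ≤ min Mt Mr) :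
    dstar Mt Mr k = cornerVal Mt Mr k := by
  rcases hk.eq_or_lt with rfl | hk
  · rw [cornerVal_min, dstar, if_pos]
    push_cast
    exact le_rfl
  · rw [dstar, if_neg]
    · simp
    · rw [not_le]
      exact_mod_cast hk

/-- A line lying below the corners of the DMT curve lies below the whole curve. -/
theorem le_dstar_of_le_cornerVal {Mt Mr : ℕ} {a b : ℝ}
    (h : ∀ k : ℕ, k ≤ min Mt Mr → a - b * k ≤ cornerVal Mt Mr k) {r : ℝ}
    (hr : r ∈ Set.Icc (0 : ℝ) (min Mt Mr : ℕ)) : a - b * r ≤ dstar Mt Mr r := by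
  rcases hr.2.eq_or_lt with rfl | hlt
  · rw [dstar_natCast le_rfl]
    exact h _ le_rfl
  · have hfloor : ⌊r⌋₊ < min Mt Mr := (Nat.floor_lt hr.1).2 hlt
    have hle : (⌊r⌋₊ : ℝ) ≤ r := Nat.floor_le hr.1
    have hlt' : r < ⌊r⌋₊ + 1 := Nat.lt_floor_add_one r
    have hleft := h _ hfloor.le
    have hright := h _ hfloor
    rw [dstar, if_neg (by push_cast at hlt; exact not_le.2 hlt)]
    push_cast at hright
    have h₁ := mul_le_mul_of_nonneg_left hleft (by linarith : (0 : ℝ) ≤ 1 - (r - ⌊r⌋₊))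
    have h₂ := mul_le_mul_of_nonneg_left hright (by linarith : (0 : ℝ) ≤ r - ⌊r⌋₊)
    linarith

theorem cornerVal_sub_cornerVal (Mt Mr j k : ℕ) :
    cornerVal Mt Mr k - cornerVal Mt Mr j = ((j : ℝ) - k) * ((Mt : ℝ) + Mr - j - k) := by
  unfold cornerVal
  ring

theorem cornerVal_add_mul_le {Mt Mr j k : ℕ} {b : ℝ} (hk : k ≤ min Mt Mr)
    (hj : j ≤ min Mt Mr)
    (hleft : j = 0 ∨ b ≤ (Mt : ℝ) + Mr - 2 * j + 1)
    (hright : j = min Mt Mr ∨ b ≥ (Mt : ℝ) + Mr - 2 * j - 1) :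
    cornerVal Mt Mr j + b * ((j : ℝ) - k) ≤ cornerVal Mt Mr k := by
  have hdiff := cornerVal_sub_cornerVal Mt Mr j k
  rcases lt_trichotomy k j with hkj | rfl | hkj
  · have hb := hleft.resolve_left (by omega)
    have hkj' : (k : ℝ) + 1 ≤ j := by exact_mod_cast hkj
    nlinarith
  · simp
  · have hb := hright.resolve_left (by omega)
    have hkj' : (j : ℝ) + 1 ≤ k := by exact_mod_cast hkj
    nlinarith

/-- The line of slope `-b` through the corner point `(j, d*(j))` lies on or below the DMT
curve on `[0, M_*]` iff `(j = 0 ∨ b ≤ Mt+Mr-2j+1) ∧ (j = M_* ∨ b ≥ Mt+Mr-2j-1)`. -/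
theorem stmt4 (Mt Mr : ℕ) (hMt : 0 < Mt) (hMr : 0 < Mr) (b : ℝ) (hb : 0 ≤ b)
    (j : ℕ) (hj : j ≤ min Mt Mr) :
    (∀ r ∈ Set.Icc (0 : ℝ) (min Mt Mr : ℕ),
        dstar Mt Mr j + b * ((j : ℝ) - r) ≤ dstar Mt Mr r) ↔
      ((j = 0 ∨ b ≤ (Mt : ℝ) + Mr - 2 * j + 1) ∧
        (j = min Mt Mr ∨ b ≥ (Mt : ℝ) + Mr - 2 * j - 1)) := by
  constructor
  · intro h
    constructor
    · rcases j with _ | i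
      · exact Or.inl rfl
      · right
        have hi : i ≤ min Mt Mr := by omega
        have hline := h i ⟨Nat.cast_nonneg i, Nat.cast_le.2 hi⟩
        rw [dstar_natCast hj, dstar_natCast hi] at hline
        have hdiff := cornerVal_sub_cornerVal Mt Mr (i + 1) i
        push_cast at *
        linarith
    · rcases hj.eq_or_lt with hj' | hj'
      · exact Or.inl hj'
      · right
        have hline := h (j + 1 : ℕ) ⟨Nat.cast_nonneg _, Nat.cast_le.2 hj'⟩
        rw [dstar_natCast hj, dstar_natCast hj'] at hline
        have hdiff := cornerVal_sub_cornerVal Mt Mr j (j + 1)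
        push_cast at *
        linarith
  · rintro ⟨hleft, hright⟩ r hr
    rw [dstar_natCast hj]
    have hline := le_dstar_of_le_cornerVal (a := cornerVal Mt Mr j + b * j) (b := b)
      (fun k hk => by linarith [cornerVal_add_mul_le hk hj hleft hright]) hr
    linarith
end

section
/- Let M_t, M_r be positive integers, M_* = min(M_t, M_r), M^* = max(M_t, M_r), and let d* : [0, ∞) → ℝ be the piecewise-linear function that interpolates the points (k, (M_t − k)(M_r − k)) for k = 0, 1, …, M_* and equals 0 for r ≥ M_*. Fix b > 0 and write Δ(b) = Σ_{i=1}^{M_*} min{b, 2i − 1 + M^* − M_*}. Then for every ε > 0 there exist a positive integer n and nonnegative reals r_1, …, r_n such that, with partial sums r̄_0 = 0 and r̄_k = r_1 + ⋯ + r_k, one has d*(r̄_{k+1}) + b·r̄_k ≥ Δ(b) − ε for every k = 0, 1, …, n − 1, and b·r̄_n ≥ Δ(b) − ε. -/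
open Finset

theorem sum_min_le (b c : ℝ) (p k : ℕ) :
    ∑ i ∈ Finset.Icc 1 (p + k), min b (2 * (i : ℝ) - 1 + c) ≤ (p : ℝ) * (p + c) + b * k := by
  induction k with
  | zero =>
    induction p with
    | zero => simp
    | succ p ih =>
      rw [Nat.add_zero] at ih ⊢
      rw [Finset.sum_Icc_succ_top (by omega)]
      have h := min_le_right b (2 * ((p + 1 : ℕ) : ℝ) - 1 + c)
      push_cast at h ih ⊢
      nlinarith
  | succ k ih =>
    rw [← Nat.add_assoc, Finset.sum_Icc_succ_top (by omega)]
    have h := min_le_left b (2 * ((p + k + 1 : ℕ) : ℝ) - 1 + c)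
    push_cast at h ih ⊢
    linarith

theorem cornerVal_eq_min_max (Mt Mr k : ℕ) :
    cornerVal Mt Mr k = (min (Mt : ℝ) Mr - k) * (max (Mt : ℝ) Mr - k) := by
  unfold cornerVal
  rcases le_total (Mt : ℝ) Mr with h | h <;> simp [h, mul_comm]

theorem Delta_le_cornerVal_add (Mt Mr : ℕ) (b : ℝ) {k : ℕ} (hk : k ≤ min Mt Mr) :
    Delta Mt Mr b ≤ cornerVal Mt Mr k + b * k := by
  obtain ⟨p, hp⟩ := Nat.exists_eq_add_of_le' hk
  have hp' : min (Mt : ℝ) Mr = p + k := by exact_mod_cast hp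
  have h := sum_min_le b (max (Mt : ℝ) Mr - min (Mt : ℝ) Mr) p k
  rw [← hp] at h
  rw [cornerVal_eq_min_max]
  unfold Delta
  simp only [add_sub_assoc] at h ⊢
  refine h.trans (le_of_eq ?_)
  rw [hp']
  ring

theorem Delta_le_mul_min (Mt Mr : ℕ) (b : ℝ) : Delta Mt Mr b ≤ b * min (Mt : ℝ) Mr := by
  have h := Delta_le_cornerVal_add Mt Mr b (le_refl (min Mt Mr))
  rw [cornerVal_eq_min_max] at h
  push_cast at h
  linarith

theorem Delta_le_dstar_add (Mt Mr : ℕ) {b : ℝ} (hb : 0 ≤ b) {y : ℝ} (hy : 0 ≤ y) :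
    Delta Mt Mr b ≤ dstar Mt Mr y + b * y := by
  unfold dstar
  split_ifs with h
  · have h1 := Delta_le_mul_min Mt Mr b
    have h2 := mul_le_mul_of_nonneg_left h hb
    linarith
  · have hfl := Nat.floor_le hy
    have hlt := Nat.lt_floor_add_one y
    have hk : ⌊y⌋₊ + 1 ≤ min Mt Mr := by
      have h3 : (⌊y⌋₊ : ℝ) < ((min Mt Mr : ℕ) : ℝ) := by
        push_cast
        exact hfl.trans_lt (not_le.mp h)
      exact_mod_cast h3
    have h1 := Delta_le_cornerVal_add Mt Mr b ((Nat.le_succ _).trans hk)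
    have h2 := Delta_le_cornerVal_add Mt Mr b hk
    have h1' := mul_le_mul_of_nonneg_left h1 (by linarith : 0 ≤ 1 - (y - ⌊y⌋₊))
    have h2' := mul_le_mul_of_nonneg_left h2 (by linarith : 0 ≤ y - ⌊y⌋₊)
    push_cast at h2'
    linarith

/-- Achievability: for every `ε > 0` there are finitely many layers with nonnegative
multiplexing gains `r_1,…,r_n` (here `r 0, …, r (n-1)`, with partial sums
`r̄_k = ∑_{j<k} r j`) whose achieved exponents `d*(r̄_{k+1}) + b·r̄_k` (for `k < n`)
and `b·r̄_n` are all at least `Δ(b) - ε`. -/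
theorem stmt5 (Mt Mr : ℕ) (hMt : 0 < Mt) (hMr : 0 < Mr) (b : ℝ) (hb : 0 < b)
    (ε : ℝ) (hε : 0 < ε) :
    ∃ n : ℕ, 0 < n ∧ ∃ r : ℕ → ℝ, (∀ k, 0 ≤ r k) ∧
      (∀ k < n, Delta Mt Mr b - ε ≤
        dstar Mt Mr (∑ j ∈ Finset.range (k + 1), r j) + b * ∑ j ∈ Finset.range k, r j) ∧
      Delta Mt Mr b - ε ≤ b * ∑ j ∈ Finset.range n, r j := by
  obtain ⟨n, hn⟩ := exists_nat_gt (b * min (Mt : ℝ) Mr / ε)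
  have hM : 0 < min (Mt : ℝ) Mr := lt_min (by exact_mod_cast hMt) (by exact_mod_cast hMr)
  have hn0 : (0 : ℝ) < n := lt_trans (by positivity) hn
  have hδ : 0 ≤ min (Mt : ℝ) Mr / n := by positivity
  refine ⟨n, by exact_mod_cast hn0, fun _ => min (Mt : ℝ) Mr / n, fun _ => hδ, ?_, ?_⟩
  · intro k _
    have hstep : b * (min (Mt : ℝ) Mr / n) ≤ ε := by
      rw [div_lt_iff₀ hε] at hn
      rw [← mul_div_assoc, div_le_iff₀ hn0]
      linarith
    have hsum : 0 ≤ ∑ _j ∈ Finset.range (k + 1), min (Mt : ℝ) Mr / n :=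
      Finset.sum_nonneg fun _ _ => hδ
    have h := Delta_le_dstar_add Mt Mr hb.le hsum
    have hsucc := Finset.sum_range_succ (fun _ => min (Mt : ℝ) Mr / n) k
    have hmul := congrArg (b * ·) hsucc
    simp only [mul_add] at hmul
    linarith
  · have h := Delta_le_mul_min Mt Mr b
    rw [Finset.sum_const, Finset.card_range, nsmul_eq_mul, mul_div_cancel₀ _ hn0.ne']
    linarith
end
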